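/- arXiv:2507.07080 — 2 statements merged into one kernel-verified Lean document; each statement's English description precedes it below -/
import Mathlib

section
/- Let N be a ℤ-graded R-module generated as an R-module by homogeneous elements F, G, H of degrees a, b, c respectively, and let (δ, D) be a degree-one derivation pair on N. If c ≥ a + 2 and c ≥ b + 2, then the R-submodule span_R{F, G} generated by F and G is D-stable. -/
open MvPolynomial

noncomputable section

/-- `R = ℂ[x,y]`. -/
abbrev Rpoly : Type := MvPolynomial (Fin 2) ℂ

/-- The degree-`k` graded piece of `R = ℂ[x,y]` (total degree), zero for negative `k`. -/
def Rgrade (k : ℤ) : Submodule ℂ Rpoly :=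
  if 0 ≤ k then homogeneousSubmodule (Fin 2) ℂ k.toNat else ⊥

/-- A ℤ-grading (by ℂ-subspaces) on an `R = ℂ[x,y]`-module `N`, compatible with the
grading of `R` by total degree, together with a degree-one derivation pair `(δ, D)`. -/
structure DerivPair (N : Type) [AddCommGroup N] [Module ℂ N] [Module Rpoly N]
    [IsScalarTower ℂ Rpoly N] where
  grade : ℤ → Submodule ℂ N
  internal : DirectSum.IsInternal grade
  smul_mem : ∀ (k ξ : ℤ) (r : Rpoly) (n : N),
    r ∈ Rgrade k → n ∈ grade ξ → r • n ∈ grade (k + ξ)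
  δ : Rpoly →ₗ[ℂ] Rpoly
  δ_leibniz : ∀ r s : Rpoly, δ (r * s) = δ r * s + r * δ s
  δ_grade : ∀ (k : ℤ) (r : Rpoly), r ∈ Rgrade k → δ r ∈ Rgrade (k + 1)
  D : N →ₗ[ℂ] N
  D_grade : ∀ (ξ : ℤ) (n : N), n ∈ grade ξ → D n ∈ grade (ξ + 1)
  D_leibniz : ∀ (r : Rpoly) (n : N), D (r • n) = δ r • n + r • D n

/-- An `R`-submodule `L ⊆ N` is `D`-stable if `D(L) ⊆ L`. -/
def DStable {N : Type} [AddCommGroup N] [Module ℂ N] [Module Rpoly N]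
    [IsScalarTower ℂ Rpoly N] (P : DerivPair N) (L : Submodule Rpoly N) : Prop :=
  ∀ x ∈ L, P.D x ∈ L

/-- `N` is `D`-simple if its only `D`-stable `R`-submodules are `0` and `N`. -/
def DSimple {N : Type} [AddCommGroup N] [Module ℂ N] [Module Rpoly N]
    [IsScalarTower ℂ Rpoly N] (P : DerivPair N) : Prop :=
  ∀ L : Submodule Rpoly N, DStable P L → L = ⊥ ∨ L = ⊤

/-- A polynomial multiple of a homogeneous element has each component below `c` in `L`, if
every homogeneous multiple either lies in `L` or has degree at least `c`. -/
lemma proj_smul_mem_aux {N : Type} [AddCommGroup N] [Module ℂ N]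
    [Module Rpoly N] [IsScalarTower ℂ Rpoly N] (P : DerivPair N)
    [DirectSum.Decomposition P.grade] (L : Submodule Rpoly N) (X : N) (e c d : ℤ)
    (hX : X ∈ P.grade e) (hL : X ∈ L ∨ c ≤ e) (hd : d < c) (r : Rpoly) :
    ((DirectSum.decompose P.grade (r • X) d : P.grade d) : N) ∈ L := by
  have hom : ∀ k : ℕ, ((DirectSum.decompose P.grade
      (homogeneousComponent k r • X) d : P.grade d) : N) ∈ L := by
    intro k
    have hm : homogeneousComponent k r • X ∈ P.grade ((k : ℤ) + e) := by
      apply P.smul_mem _ _ _ _ _ hX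
      simp only [Rgrade, Int.natCast_nonneg, if_true, Int.toNat_natCast]
      exact homogeneousComponent_mem k r
    by_cases hk : (k : ℤ) + e = d
    · subst hk
      rw [DirectSum.decompose_of_mem_same _ hm]
      rcases hL with h | h
      · exact L.smul_mem _ h
      · omega
    · rw [DirectSum.decompose_of_mem_ne _ hm hk]
      exact L.zero_mem
  rw [← sum_homogeneousComponent r, Finset.sum_smul, DirectSum.decompose_sum]
  rw [DFinsupp.finsetSum_apply, AddSubmonoidClass.coe_finsetSum]
  exact Submodule.sum_mem _ fun k _ => hom k

/-- Elements of degree below `c` lie in the span of `F` and `G`. -/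
lemma mem_span_pair_of_lt {N : Type} [AddCommGroup N] [Module ℂ N]
    [Module Rpoly N] [IsScalarTower ℂ Rpoly N] (P : DerivPair N) (F G H : N) (a b c : ℤ)
    (hF : F ∈ P.grade a) (hG : G ∈ P.grade b) (hH : H ∈ P.grade c)
    (hgen : Submodule.span Rpoly ({F, G, H} : Set N) = ⊤) (d : ℤ) (hd : d < c)
    (x : N) (hx : x ∈ P.grade d) : x ∈ Submodule.span Rpoly ({F, G} : Set N) := by
  classical
  letI : DirectSum.Decomposition P.grade := P.internal.chooseDecomposition
  have hxt : x ∈ Submodule.span Rpoly ({F, G, H} : Set N) := hgen ▸ Submodule.mem_top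
  obtain ⟨r, s, t, h⟩ := Submodule.mem_span_triple.1 hxt
  have hFL : F ∈ Submodule.span Rpoly ({F, G} : Set N) := Submodule.subset_span (by simp)
  have hGL : G ∈ Submodule.span Rpoly ({F, G} : Set N) := Submodule.subset_span (by simp)
  rw [← DirectSum.decompose_of_mem_same P.grade hx, ← h, DirectSum.decompose_add,
    DirectSum.decompose_add]
  exact Submodule.add_mem _ (Submodule.add_mem _
    (proj_smul_mem_aux P _ F a c d hF (Or.inl hFL) hd r)
    (proj_smul_mem_aux P _ G b c d hG (Or.inl hGL) hd s))
    (proj_smul_mem_aux P _ H c c d hH (Or.inr le_rfl) hd t)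

/-- If `N` is generated by homogeneous `F, G, H` of degrees `a, b, c` with `c ≥ a + 2` and
`c ≥ b + 2`, then the `R`-submodule generated by `F` and `G` is `D`-stable. -/
theorem span_pair_DStable_of_degree_gap {N : Type} [AddCommGroup N] [Module ℂ N]
    [Module Rpoly N] [IsScalarTower ℂ Rpoly N] (P : DerivPair N) (F G H : N) (a b c : ℤ)
    (hF : F ∈ P.grade a) (hG : G ∈ P.grade b) (hH : H ∈ P.grade c)
    (hgen : Submodule.span Rpoly ({F, G, H} : Set N) = ⊤)
    (hca : a + 2 ≤ c) (hcb : b + 2 ≤ c) :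
    DStable P (Submodule.span Rpoly ({F, G} : Set N)) := by
  intro x hx
  have hFL : F ∈ Submodule.span Rpoly ({F, G} : Set N) := Submodule.subset_span (by simp)
  have hGL : G ∈ Submodule.span Rpoly ({F, G} : Set N) := Submodule.subset_span (by simp)
  have hDF := mem_span_pair_of_lt P F G H a b c hF hG hH hgen (a + 1) (by omega) _
    (P.D_grade a F hF)
  have hDG := mem_span_pair_of_lt P F G H a b c hF hG hH hgen (b + 1) (by omega) _
    (P.D_grade b G hG)
  obtain ⟨r, s, rfl⟩ := Submodule.mem_span_pair.1 hx
  rw [map_add, P.D_leibniz, P.D_leibniz]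
  exact Submodule.add_mem _
    (Submodule.add_mem _ (Submodule.smul_mem _ _ hFL) (Submodule.smul_mem _ _ hDF))
    (Submodule.add_mem _ (Submodule.smul_mem _ _ hGL) (Submodule.smul_mem _ _ hDG))
end
end

section
/- Let N be a ℤ-graded R-module generated as an R-module by homogeneous elements F₁, …, Fₙ of degrees d₁, …, dₙ, and let (δ, D) be a degree-one derivation pair on N. Let t be an integer and let S = {i : dᵢ ≤ t}. If dⱼ ≥ t + 2 for every index j ∉ S, then the R-submodule span_R{Fᵢ : i ∈ S} is D-stable. -/
open MvPolynomial

noncomputable section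

/-- Degree-gap lemma: if `N` is generated by homogeneous `Fᵢ` of degrees `dᵢ`, and every
generator of degree `> t` in fact has degree `≥ t + 2`, then the `R`-submodule generated
by the `Fᵢ` with `dᵢ ≤ t` is `D`-stable. -/
theorem span_low_degree_DStable {N : Type} [AddCommGroup N] [Module ℂ N] [Module Rpoly N]
    [IsScalarTower ℂ Rpoly N] (P : DerivPair N) {ι : Type} (F : ι → N) (d : ι → ℤ)
    (hhom : ∀ i, F i ∈ P.grade (d i))
    (hgen : Submodule.span Rpoly (Set.range F) = ⊤)
    (t : ℤ) (hgap : ∀ j, ¬ d j ≤ t → t + 2 ≤ d j) :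
    DStable P (Submodule.span Rpoly (F '' {i | d i ≤ t})) := by
  classical
  letI : DirectSum.Decomposition P.grade := P.internal.chooseDecomposition
  set L := Submodule.span Rpoly (F '' {i | d i ≤ t}) with hL
  have hFL : ∀ i, d i ≤ t → F i ∈ L := fun i hi => Submodule.subset_span ⟨i, hi, rfl⟩
  -- homogeneous components of low degree lie in `L`
  have key : ∀ ξ : ℤ, ξ ≤ t + 1 → ∀ n : N, (DirectSum.decompose P.grade n ξ : N) ∈ L := by
    intro ξ hξ n
    have hadd : ∀ a b : N, (DirectSum.decompose P.grade a ξ : N) ∈ L →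
        (DirectSum.decompose P.grade b ξ : N) ∈ L →
        (DirectSum.decompose P.grade (a + b) ξ : N) ∈ L := by
      intro a b ha hb
      rw [DirectSum.decompose_add, DirectSum.add_apply, Submodule.coe_add]
      exact L.add_mem ha hb
    have hzero : (DirectSum.decompose P.grade (0 : N) ξ : N) ∈ L := by
      rw [DirectSum.decompose_zero, DirectSum.zero_apply, Submodule.coe_zero]
      exact L.zero_mem
    have hhomog : ∀ (k : ℕ) (r : Rpoly) (i : ι), r ∈ homogeneousSubmodule (Fin 2) ℂ k →
        (DirectSum.decompose P.grade (r • F i) ξ : N) ∈ L := by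
      intro k r i hr
      have hr' : r ∈ Rgrade (k : ℤ) := by
        simpa [Rgrade] using hr
      have hm := P.smul_mem k (d i) r (F i) hr' (hhom i)
      by_cases h : (k : ℤ) + d i = ξ
      · rw [h] at hm
        rw [DirectSum.decompose_of_mem_same P.grade hm]
        apply L.smul_mem
        apply hFL
        by_contra hc
        have := hgap i hc
        omega
      · rw [DirectSum.decompose_of_mem_ne P.grade hm h]
        exact L.zero_mem
    have hsmul : ∀ (r : Rpoly) (i : ι), (DirectSum.decompose P.grade (r • F i) ξ : N) ∈ L := by
      intro r i
      rw [← MvPolynomial.sum_homogeneousComponent r, Finset.sum_smul]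
      refine Finset.sum_induction _ (fun a => (DirectSum.decompose P.grade a ξ : N) ∈ L)
        hadd hzero ?_
      intro k _
      exact hhomog k _ i (MvPolynomial.homogeneousComponent_mem k r)
    have hn : n ∈ Submodule.span Rpoly (Set.range F) := by rw [hgen]; trivial
    obtain ⟨c, rfl⟩ := (Finsupp.mem_span_range_iff_exists_finsupp).1 hn
    exact Finset.sum_induction _ (fun a => (DirectSum.decompose P.grade a ξ : N) ∈ L)
      hadd hzero (fun i _ => hsmul (c i) i)
  intro x hx
  induction hx using Submodule.span_induction with
  | mem x hx =>
    obtain ⟨i, hi, rfl⟩ := hx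
    have h := key (d i + 1) (by have : d i ≤ t := hi; omega) (P.D (F i))
    rwa [DirectSum.decompose_of_mem_same P.grade (P.D_grade _ _ (hhom i))] at h
  | zero => rw [map_zero]; exact L.zero_mem
  | add a b _ _ ha hb => rw [map_add]; exact L.add_mem ha hb
  | smul r a ha' ha =>
    rw [P.D_leibniz]
    exact L.add_mem (L.smul_mem _ ha') (L.smul_mem _ ha)
end
end
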